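/- Let ψ : ℝ³ → Sym² be any smooth field of symmetric matrices. Define τ = 2 Σ_{ℓ,m} ∂_ℓ ∂_m ψ_{ℓm}, define (Q̌ψ)_{ij} = −4 Δψ_{ij} + 4( ∂_i Σ_k ∂_k ψ_{jk} + ∂_j Σ_k ∂_k ψ_{ik} ) − (8/3) δ_{ij} Σ_{k,ℓ} ∂_k ∂_ℓ ψ_{kℓ} + 2 Δ(tr ψ) δ_{ij} − 2 ∂_i ∂_j (tr ψ), and set K_{ij} = (Q̌ψ)_{ij} + (1/3) τ δ_{ij}. Then tr K = τ at every point, and K satisfies the flat vacuum vector constraint: for each i, Σ_j ∂_j ( K_{ij} − (tr K) δ_{ij} ) = 0 identically on ℝ³. -/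

import Mathlib

open MeasureTheory
open scoped BigOperators

/-- Partial derivative in the `i`-th coordinate direction on `ℝ³`. -/
noncomputable def pd (i : Fin 3) (f : (Fin 3 → ℝ) → ℝ) : (Fin 3 → ℝ) → ℝ :=
  fun x => fderiv ℝ f x (Pi.single i 1)

/-- The Levi-Civita symbol `ε_{ijk}` on three indices. -/
def eps : Fin 3 → Fin 3 → Fin 3 → ℝ := fun i j k =>
  if (i, j, k) = ((0 : Fin 3), (1 : Fin 3), (2 : Fin 3)) ∨
     (i, j, k) = ((1 : Fin 3), (2 : Fin 3), (0 : Fin 3)) ∨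
     (i, j, k) = ((2 : Fin 3), (0 : Fin 3), (1 : Fin 3)) then 1
  else if (i, j, k) = ((2 : Fin 3), (1 : Fin 3), (0 : Fin 3)) ∨
     (i, j, k) = ((1 : Fin 3), (0 : Fin 3), (2 : Fin 3)) ∨
     (i, j, k) = ((0 : Fin 3), (2 : Fin 3), (1 : Fin 3)) then -1
  else 0

/-- The Kronecker delta `δ_{ij}`. -/
def kdelta (i j : Fin 3) : ℝ := if i = j then 1 else 0

/-- Scalar fields on `ℝ³`. -/
abbrev Fld := (Fin 3 → ℝ) → ℝ

/-- Vector fields on `ℝ³`, given by their components. -/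
abbrev VecFld := Fin 3 → Fld

/-- (Symmetric-)matrix fields on `ℝ³`, given by their components. -/
abbrev MatFld := Fin 3 → Fin 3 → Fld

/-- `(rot₁ X)_i = Σ_{j,k} ε_{ijk} ∂_j X_k`. -/
noncomputable def rot1 (X : VecFld) : VecFld := fun i x => ∑ j, ∑ k, eps i j k * pd j (X k) x

/-- `div₁ X = Σ_i ∂_i X_i`. -/
noncomputable def div1 (X : VecFld) : Fld := fun x => ∑ i, pd i (X i) x

/-- `(div₂ h)_i = Σ_j ∂_j h_{ij}`. -/
noncomputable def div2 (h : MatFld) : VecFld := fun i x => ∑ j, pd j (h i j) x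

/-- `(rot₂ h)_{ij} = Σ_{k,ℓ} ( ε_{kℓi} ∂_k h_{ℓj} + ε_{kℓj} ∂_k h_{ℓi} )`. -/
noncomputable def rot2 (h : MatFld) : MatFld :=
  fun i j x => ∑ k, ∑ l, (eps k l i * pd k (h l j) x + eps k l j * pd k (h l i) x)

/-- The conformal Killing operator
`(L X)_{ij} = ∂_i X_j + ∂_j X_i − (2/3) δ_{ij} Σ_k ∂_k X_k`. -/
noncomputable def Lop (X : VecFld) : MatFld :=
  fun i j x => pd i (X j) x + pd j (X i) x - (2/3) * kdelta i j * div1 X x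

/-- The Laplacian `Δf = Σ_k ∂_k ∂_k f`. -/
noncomputable def lap (f : Fld) : Fld := fun x => ∑ k, pd k (pd k f) x

/-- `τ = 2 Σ_{ℓ,m} ∂_ℓ ∂_m ψ_{ℓm}`. -/
noncomputable def tauF (ψ : MatFld) : Fld := fun x => 2 * ∑ l, ∑ m, pd l (pd m (ψ l m)) x

/-- The operator `Q̌`:
`(Q̌ψ)_{ij} = −4 Δψ_{ij} + 4( ∂_i Σ_k ∂_k ψ_{jk} + ∂_j Σ_k ∂_k ψ_{ik} )
 − (8/3) δ_{ij} Σ_{k,ℓ} ∂_k ∂_ℓ ψ_{kℓ} + 2 Δ(tr ψ) δ_{ij} − 2 ∂_i ∂_j (tr ψ)`. -/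
noncomputable def Qcheck (ψ : MatFld) : MatFld := fun i j x =>
  -4 * lap (ψ i j) x
  + 4 * (pd i (fun y => ∑ k, pd k (ψ j k) y) x + pd j (fun y => ∑ k, pd k (ψ i k) y) x)
  - (8/3) * kdelta i j * (∑ k, ∑ l, pd k (pd l (ψ k l)) x)
  + 2 * lap (fun y => ∑ m, ψ m m y) x * kdelta i j
  - 2 * pd i (pd j (fun y => ∑ m, ψ m m y)) x

/-- `K_{ij} = (Q̌ψ)_{ij} + (1/3) τ δ_{ij}`. -/
noncomputable def Kfield (ψ : MatFld) : MatFld := fun i j x =>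
  Qcheck ψ i j x + (1/3) * tauF ψ x * kdelta i j

/-- The real vector space of smooth scalar fields on `ℝ³`. -/
def smoothFld : Submodule ℝ Fld where
  carrier := {f | ContDiff ℝ (⊤ : ℕ∞) f}
  add_mem' {f g} (hf : ContDiff ℝ (⊤ : ℕ∞) f) (hg : ContDiff ℝ (⊤ : ℕ∞) g) := hf.add hg
  zero_mem' := show ContDiff ℝ (⊤ : ℕ∞) (fun _ => (0 : ℝ)) from contDiff_const
  smul_mem' c {f} (hf : ContDiff ℝ (⊤ : ℕ∞) f) := hf.const_smul c

theorem contDiff_smoothFld (f : smoothFld) : ContDiff ℝ (⊤ : ℕ∞) (f : Fld) := f.2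

theorem differentiable_smoothFld (f : smoothFld) : Differentiable ℝ (f : Fld) :=
  (contDiff_smoothFld f).differentiable (by simp)

theorem contDiff_pd {f : Fld} (hf : ContDiff ℝ (⊤ : ℕ∞) f) (i : Fin 3) :
    ContDiff ℝ (⊤ : ℕ∞) (pd i f) :=
  (hf.fderiv_right (m := ((⊤ : ℕ∞) : WithTop ℕ∞)) (by simp)).clm_apply contDiff_const

/-- Partial derivatives as linear endomorphisms of the space of smooth scalar fields. -/
noncomputable def smoothPd (i : Fin 3) : smoothFld →ₗ[ℝ] smoothFld where
  toFun f := ⟨pd i f, contDiff_pd (contDiff_smoothFld f) i⟩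
  map_add' f g := by
    ext x
    simp [pd, fderiv_add (differentiable_smoothFld f x) (differentiable_smoothFld g x)]
  map_smul' c f := by
    ext x
    simp [pd, fderiv_const_smul (differentiable_smoothFld f x) c]

theorem pd_coe (i : Fin 3) (f : smoothFld) : pd i (f : Fld) = (smoothPd i f : Fld) := rfl

theorem smoothPd_comm (i j : Fin 3) (f : smoothFld) :
    smoothPd i (smoothPd j f) = smoothPd j (smoothPd i f) := by
  have hd : Differentiable ℝ (fderiv ℝ (f : Fld)) :=
    ((contDiff_infty.1 (contDiff_smoothFld f) 2).fderiv_right (m := 1) (by norm_num)).differentiable (by simp)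
  have key : ∀ (a b : Fin 3) (x : Fin 3 → ℝ), pd a (pd b f) x =
      fderiv ℝ (fderiv ℝ (f : Fld)) x (Pi.single a 1) (Pi.single b 1) := by
    intro a b x
    unfold pd
    rw [fderiv_clm_apply (hd x) (differentiableAt_const _)]
    simp
  have hs : ∀ x, IsSymmSndFDerivAt ℝ (f : Fld) x := fun x =>
    (contDiff_infty.1 (contDiff_smoothFld f) 2).contDiffAt.isSymmSndFDerivAt (by simp)
  ext x
  change pd i (pd j f) x = pd j (pd i f) x
  rw [key, key, (hs x).eq]

theorem sum_coe_smoothFld (f : Fin 3 → smoothFld) :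
    (fun y => ∑ k, (f k : Fld) y) = ((∑ k, f k : smoothFld) : Fld) := by
  ext y
  simp

/-- The field `K` with smooth components. -/
noncomputable def smoothK (Ψ : Fin 3 → Fin 3 → smoothFld) (i j : Fin 3) : smoothFld :=
  (-4 : ℝ) • ∑ k, smoothPd k (smoothPd k (Ψ i j))
  + (4 : ℝ) • (smoothPd i (∑ k, smoothPd k (Ψ j k)) + smoothPd j (∑ k, smoothPd k (Ψ i k)))
  - ((8/3) * kdelta i j) • ∑ k, ∑ l, smoothPd k (smoothPd l (Ψ k l))
  + (2 * kdelta i j) • ∑ k, smoothPd k (smoothPd k (∑ m, Ψ m m))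
  - (2 : ℝ) • smoothPd i (smoothPd j (∑ m, Ψ m m))
  + ((2/3) * kdelta i j) • ∑ k, ∑ l, smoothPd k (smoothPd l (Ψ k l))

theorem Kfield_coe (Ψ : Fin 3 → Fin 3 → smoothFld) (i j : Fin 3) :
    Kfield (fun i j => (Ψ i j : Fld)) i j = (smoothK Ψ i j : Fld) := by
  ext x
  simp only [Kfield, Qcheck, tauF, lap, smoothK, pd_coe, sum_coe_smoothFld]
  simp only [Submodule.coe_add, Submodule.coe_sub, Submodule.coe_smul, Submodule.coe_sum,
    Pi.add_apply, Pi.sub_apply, Pi.smul_apply, Finset.sum_apply, smul_eq_mul]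
  ring

theorem trace_smoothK (Ψ : Fin 3 → Fin 3 → smoothFld) :
    ∑ i, smoothK Ψ i i = (2 : ℝ) • ∑ k, ∑ l, smoothPd k (smoothPd l (Ψ k l)) := by
  simp only [smoothK, kdelta, Fin.sum_univ_three, map_add, if_true]
  module

theorem div_smoothK (Ψ : Fin 3 → Fin 3 → smoothFld) (hΨ : ∀ i j, Ψ i j = Ψ j i) (i : Fin 3) :
    ∑ j, smoothPd j (smoothK Ψ i j - kdelta i j • ∑ m, smoothK Ψ m m) = 0 := by
  rw [trace_smoothK]
  have h10 := hΨ 1 0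
  have h20 := hΨ 2 0
  have h21 := hΨ 2 1
  have c10 := smoothPd_comm 1 0
  have c20 := smoothPd_comm 2 0
  have c21 := smoothPd_comm 2 1
  fin_cases i <;>
  · simp [smoothK, kdelta, Fin.sum_univ_three, h10, h20, h21, c10, c20, c21,
      -neg_smul]
    module

/-- for any smooth symmetric field `ψ`, the field `K = Q̌ψ + (1/3) τ δ`
has trace `τ` and satisfies the flat vacuum vector constraint
`Σ_j ∂_j ( K_{ij} − (tr K) δ_{ij} ) = 0`. -/
theorem stmt1 (ψ : MatFld)
    (hψ_smooth : ∀ i j, ContDiff ℝ (⊤ : ℕ∞) (ψ i j))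
    (hψ_symm : ∀ i j, ψ i j = ψ j i) :
    (∀ x, ∑ i, Kfield ψ i i x = tauF ψ x) ∧
    (∀ (i : Fin 3) (x : Fin 3 → ℝ),
      ∑ j, pd j (fun y => Kfield ψ i j y - (∑ m, Kfield ψ m m y) * kdelta i j) x = 0) := by
  obtain ⟨Ψ, rfl⟩ : ∃ Ψ : Fin 3 → Fin 3 → smoothFld, ψ = fun i j => (Ψ i j : Fld) :=
    ⟨fun i j => ⟨ψ i j, hψ_smooth i j⟩, rfl⟩
  have hΨ : ∀ i j, Ψ i j = Ψ j i := fun i j => Subtype.ext (hψ_symm i j)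
  constructor
  · intro x
    have h := congrFun (congrArg Subtype.val (trace_smoothK Ψ)) x
    simpa [Kfield_coe, tauF, pd_coe] using h
  · intro i x
    have h := congrFun (congrArg Subtype.val (div_smoothK Ψ hΨ i)) x
    have e : ∀ j, (fun y => Kfield (fun i j => (Ψ i j : Fld)) i j y
        - (∑ m, Kfield (fun i j => (Ψ i j : Fld)) m m y) * kdelta i j)
        = ((smoothK Ψ i j - kdelta i j • ∑ m, smoothK Ψ m m : smoothFld) : Fld) := by
      intro j
      ext y
      simp [Kfield_coe, mul_comm]
    simp only [e, pd_coe]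
    simpa only [Submodule.coe_sum, Finset.sum_apply, Submodule.coe_zero, Pi.zero_apply] using h
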